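/- Let ε ≥ 0 and p < 1 be real numbers. If a function f : ℝⁿ \ B → ℝⁿ satisfies ||⟨f(x), f(y)⟩| − |⟨x, y⟩|| ≤ ε·‖x‖^p·‖y‖^p for all x, y ∈ ℝⁿ \ B, then f satisfies the generalized orthogonality equation |⟨f(x), f(y)⟩| = |⟨x, y⟩| for all x, y ∈ ℝⁿ \ B. -/

import Mathlib

open scoped RealInnerProductSpace
open Filter Topology

section AsymptoticRescaling

variable {E : Type*} [NormedAddCommGroup E] [InnerProductSpace ℝ E]

theorem abs_inner_rescale_sub_le {d ε p : ℝ} {f : E → E}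
    (hf : ∀ x y : E, d ≤ ‖x‖ → d ≤ ‖y‖ →
      |abs ⟪f x, f y⟫ - abs ⟪x, y⟫| ≤ ε * ‖x‖ ^ p * ‖y‖ ^ p)
    {x y : E} (hx : d ≤ ‖x‖) (hy : d ≤ ‖y‖) {t : ℝ} (ht : 1 ≤ t) :
    |abs ⟪t⁻¹ • f (t • x), f y⟫ - abs ⟪x, y⟫| ≤ t ^ (p - 1) * (ε * ‖x‖ ^ p * ‖y‖ ^ p) := by
  have ht0 : 0 < t := by linarith
  have hn : ‖t • x‖ = t * ‖x‖ := by rw [norm_smul, Real.norm_of_nonneg ht0.le]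
  have htx : d ≤ ‖t • x‖ := by
    rw [hn]; nlinarith [norm_nonneg x]
  have h := hf (t • x) y htx hy
  rw [hn, Real.mul_rpow ht0.le (norm_nonneg x), real_inner_smul_left, abs_mul,
    abs_of_pos ht0] at h
  rw [real_inner_smul_left, abs_mul, abs_of_pos (inv_pos.2 ht0), Real.rpow_sub_one ht0.ne']
  have e : t⁻¹ * |⟪f (t • x), f y⟫| - |⟪x, y⟫|
      = t⁻¹ * (|⟪f (t • x), f y⟫| - t * |⟪x, y⟫|) := by
    field_simp
  rw [e, abs_mul, abs_of_pos (inv_pos.2 ht0)]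
  calc t⁻¹ * |(|⟪f (t • x), f y⟫| - t * |⟪x, y⟫|)|
      ≤ t⁻¹ * (ε * (t ^ p * ‖x‖ ^ p) * ‖y‖ ^ p) := by gcongr
    _ = t ^ p / t * (ε * ‖x‖ ^ p * ‖y‖ ^ p) := by ring

theorem tendsto_abs_inner_rescale {d ε p : ℝ} (hp : p < 1) {f : E → E}
    (hf : ∀ x y : E, d ≤ ‖x‖ → d ≤ ‖y‖ →
      |abs ⟪f x, f y⟫ - abs ⟪x, y⟫| ≤ ε * ‖x‖ ^ p * ‖y‖ ^ p)
    {x y : E} (hx : d ≤ ‖x‖) (hy : d ≤ ‖y‖) :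
    Tendsto (fun t : ℝ => |⟪t⁻¹ • f (t • x), f y⟫|) atTop (𝓝 |⟪x, y⟫|) := by
  have h0 : Tendsto (fun t : ℝ => t ^ (p - 1) * (ε * ‖x‖ ^ p * ‖y‖ ^ p)) atTop (𝓝 0) := by
    have := (tendsto_rpow_neg_atTop (show 0 < 1 - p by linarith)).mul_const
      (ε * ‖x‖ ^ p * ‖y‖ ^ p)
    simpa using this
  rw [tendsto_iff_norm_sub_tendsto_zero]
  refine squeeze_zero' (.of_forall fun _ => norm_nonneg _) ?_ h0
  filter_upwards [eventually_ge_atTop 1] with t ht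
  exact abs_inner_rescale_sub_le hf hx hy ht

theorem norm_rescale_sq_le {d ε p : ℝ} (hε : 0 ≤ ε) (hp : p < 1) {f : E → E}
    (hf : ∀ x y : E, d ≤ ‖x‖ → d ≤ ‖y‖ →
      |abs ⟪f x, f y⟫ - abs ⟪x, y⟫| ≤ ε * ‖x‖ ^ p * ‖y‖ ^ p)
    {x : E} (hx : d ≤ ‖x‖) {t : ℝ} (ht : 1 ≤ t) :
    ‖t⁻¹ • f (t • x)‖ ^ 2 ≤ ‖x‖ ^ 2 + ε * ‖x‖ ^ p * ‖x‖ ^ p := by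
  have ht0 : 0 < t := by linarith
  have hn : ‖t • x‖ = t * ‖x‖ := by rw [norm_smul, Real.norm_of_nonneg ht0.le]
  have htx : d ≤ ‖t • x‖ := by
    rw [hn]; nlinarith [norm_nonneg x]
  have h := (abs_le.1 (hf (t • x) (t • x) htx htx)).2
  have hpow : t ^ p ≤ t := by
    simpa using Real.rpow_le_rpow_of_exponent_le ht hp.le
  rw [real_inner_self_eq_norm_sq, real_inner_self_eq_norm_sq, abs_of_nonneg (sq_nonneg _),
    abs_of_nonneg (sq_nonneg _), hn, Real.mul_rpow ht0.le (norm_nonneg x)] at h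
  have h2 : ε * (t ^ p * ‖x‖ ^ p) * (t ^ p * ‖x‖ ^ p)
      ≤ ε * (t * ‖x‖ ^ p) * (t * ‖x‖ ^ p) := by gcongr
  rw [norm_smul, norm_inv, Real.norm_of_nonneg ht0.le, mul_pow, inv_pow,
    inv_mul_le_iff₀ (by positivity)]
  linarith

/-- The limits of `t⁻¹ • f (t • x)` along an ultrafilter finer than `atTop` give a map
preserving `|⟪·, ·⟫|`, both against itself and against `f`. -/
theorem exists_asymptotic_map [ProperSpace E] {d ε p : ℝ} (hε : 0 ≤ ε) (hp : p < 1) {f : E → E}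
    (hf : ∀ x y : E, d ≤ ‖x‖ → d ≤ ‖y‖ →
      |abs ⟪f x, f y⟫ - abs ⟪x, y⟫| ≤ ε * ‖x‖ ^ p * ‖y‖ ^ p) :
    ∃ T : E → E,
      (∀ x y : E, d ≤ ‖x‖ → d ≤ ‖y‖ → |⟪T x, f y⟫| = |⟪x, y⟫|) ∧
      (∀ x y : E, d ≤ ‖x‖ → d ≤ ‖y‖ → |⟪T x, T y⟫| = |⟪x, y⟫|) := by
  let F : Ultrafilter ℝ := Ultrafilter.of atTop
  have hF : (F : Filter ℝ) ≤ atTop := Ultrafilter.of_le _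
  have hlim : ∀ x : E, ∃ v : E, d ≤ ‖x‖ →
      Tendsto (fun t : ℝ => t⁻¹ • f (t • x)) F (𝓝 v) := by
    intro x
    by_cases hx : d ≤ ‖x‖
    · obtain ⟨v, -, hv⟩ := (isCompact_closedBall (0 : E)
        √(‖x‖ ^ 2 + ε * ‖x‖ ^ p * ‖x‖ ^ p)).ultrafilter_le_nhds
        (F.map fun t : ℝ => t⁻¹ • f (t • x)) (by
          rw [le_principal_iff]
          refine hF ?_
          filter_upwards [eventually_ge_atTop 1] with t ht
          simpa using Real.le_sqrt_of_sq_le (norm_rescale_sq_le hε hp hf hx ht))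
      exact ⟨v, fun _ => hv⟩
    · exact ⟨0, fun h => absurd h hx⟩
  choose T hT using hlim
  have hTf : ∀ x y : E, d ≤ ‖x‖ → d ≤ ‖y‖ → |⟪T x, f y⟫| = |⟪x, y⟫| := fun x y hx hy =>
    tendsto_nhds_unique ((hT x hx).inner tendsto_const_nhds).abs
      ((tendsto_abs_inner_rescale hp hf hx hy).mono_left hF)
  refine ⟨T, hTf, fun x y hx hy => ?_⟩
  refine tendsto_nhds_unique ((tendsto_const_nhds (x := T x)).inner (hT y hy)).abs
    (tendsto_const_nhds.congr' ?_)
  refine hF ?_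
  filter_upwards [eventually_ge_atTop 1] with t ht
  have ht0 : 0 < t := by linarith
  have hty : d ≤ ‖t • y‖ := by
    rw [norm_smul, Real.norm_of_nonneg ht0.le]; nlinarith [norm_nonneg y]
  rw [real_inner_smul_right, abs_mul, hTf x _ hx hty, real_inner_smul_right, ← abs_mul,
    inv_mul_cancel_left₀ ht0.ne']

theorem eq_or_eq_neg_of_abs_inner_eq {u v : E} {r : ℝ} (hu : ‖u‖ = r) (hv : ‖v‖ = r)
    (h : |⟪u, v⟫| = r ^ 2) : v = u ∨ v = -u := by
  rcases abs_choice ⟪u, v⟫ with h' | h' <;> rw [h'] at h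
  · left
    have := norm_sub_sq_real u v
    rw [hu, hv, h] at this
    have h0 : ‖u - v‖ ^ 2 = 0 := by linarith
    exact (sub_eq_zero.1 (norm_eq_zero.1 (pow_eq_zero_iff two_ne_zero |>.1 h0))).symm
  · right
    have := norm_add_sq_real u v
    rw [hu, hv] at this
    have h0 : ‖u + v‖ ^ 2 = 0 := by linarith
    exact eq_neg_of_add_eq_zero_right (norm_eq_zero.1 (pow_eq_zero_iff two_ne_zero |>.1 h0))

/-- In finite dimension, a vector whose inner products with the images of a scaled orthonormal
basis under a map `T` preserving `|⟪·, ·⟫|` agree in absolute value with those of `y` has the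
norm of `y`. -/
theorem norm_eq_of_abs_inner_eq [FiniteDimensional ℝ E] {d : ℝ} (hd : 0 < d) {T : E → E}
    (hT : ∀ x y : E, d ≤ ‖x‖ → d ≤ ‖y‖ → |⟪T x, T y⟫| = |⟪x, y⟫|) {y w : E}
    (hw : ∀ x : E, d ≤ ‖x‖ → |⟪T x, w⟫| = |⟪x, y⟫|) : ‖w‖ = ‖y‖ := by
  let e := stdOrthonormalBasis ℝ E
  have hde : ∀ i, d ≤ ‖d • e i‖ := fun i => by
    rw [norm_smul, e.norm_eq_one, mul_one, Real.norm_of_nonneg hd.le]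
  have hb : Orthonormal ℝ fun i => d⁻¹ • T (d • e i) := by
    have habs : ∀ i j, |⟪d⁻¹ • T (d • e i), d⁻¹ • T (d • e j)⟫| = |⟪e i, e j⟫| := by
      intro i j
      rw [real_inner_smul_left, real_inner_smul_right, ← mul_assoc, abs_mul,
        hT _ _ (hde i) (hde j), real_inner_smul_left, real_inner_smul_right, ← abs_mul]
      congr 1
      field_simp
    refine ⟨fun i => ?_, fun i j hij => ?_⟩
    · have := habs i i
      rw [real_inner_self_eq_norm_sq, real_inner_self_eq_norm_sq, e.norm_eq_one,
        abs_pow, abs_norm, one_pow, abs_one] at this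
      exact (pow_eq_one_iff_of_nonneg (norm_nonneg _) two_ne_zero).1 this
    · have := habs i j
      rwa [e.orthonormal.2 hij, abs_zero, abs_eq_zero] at this
  have hspan : ⊤ ≤ Submodule.span ℝ (Set.range fun i => d⁻¹ • T (d • e i)) :=
    (hb.linearIndependent.span_eq_top_of_card_eq_finrank' (by simp)).ge
  let b := OrthonormalBasis.mk hb hspan
  have hsq : ‖w‖ ^ 2 = ‖y‖ ^ 2 := by
    rw [← b.sum_sq_norm_inner_right w, ← e.sum_sq_norm_inner_right y]
    refine Finset.sum_congr rfl fun i _ => ?_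
    congr 1
    rw [OrthonormalBasis.coe_mk, real_inner_smul_left, norm_mul, Real.norm_eq_abs ⟪_, w⟫,
      hw _ (hde i), real_inner_smul_left, ← Real.norm_eq_abs, ← norm_mul,
      inv_mul_cancel_left₀ hd.ne']
  exact (pow_left_inj₀ (norm_nonneg _) (norm_nonneg _) two_ne_zero).1 hsq

end AsymptoticRescaling

theorem stmt_15 (n : ℕ) (hn : 2 ≤ n) (d : ℝ) (hd : 0 < d)
    (ε p : ℝ) (hε : 0 ≤ ε) (hp : p < 1)
    (S : Set (EuclideanSpace ℝ (Fin n))) (hS : S = {x : EuclideanSpace ℝ (Fin n) | d ≤ ‖x‖})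
    (f : EuclideanSpace ℝ (Fin n) → EuclideanSpace ℝ (Fin n))
    (hf : ∀ x ∈ S, ∀ y ∈ S,
      |abs ⟪f x, f y⟫ - abs ⟪x, y⟫| ≤ ε * ‖x‖ ^ p * ‖y‖ ^ p) :
    ∀ x ∈ S, ∀ y ∈ S, |⟪f x, f y⟫| = |⟪x, y⟫| := by
  subst hS
  obtain ⟨T, hTf, hTT⟩ := exists_asymptotic_map hε hp fun x y hx hy => hf x hx y hy
  intro x hx y hy
  have hfx : ‖f x‖ = ‖x‖ := norm_eq_of_abs_inner_eq hd hTT fun z hz => hTf z x hz hx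
  have hTx : ‖T x‖ = ‖x‖ := norm_eq_of_abs_inner_eq hd hTT fun z hz => hTT z x hz hx
  have hxx : |⟪T x, f x⟫| = ‖x‖ ^ 2 := by
    rw [hTf x x hx hx, real_inner_self_eq_norm_sq, abs_of_nonneg (sq_nonneg _)]
  rw [← hTf x y hx hy]
  rcases eq_or_eq_neg_of_abs_inner_eq hTx hfx hxx with h | h <;> simp [h]
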